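/- Let G be a topological groupoid and let G⁽⁰⁾×[0,1]×𝕋 →ᶦ Σ →ʲ G×[0,1] be a twist over the bundle groupoid G×[0,1]. Let V ⊆ G be an open subset and 0 ≤ a < b < c ≤ 1. If there exist continuous sections s₁ : V×[a,b] → Σ and s₂ : V×[b,c] → Σ of j, then there exists a continuous section s : V×[a,c] → Σ of j. -/

import Mathlib

set_option autoImplicit false

/-- A topological groupoid: a set `G` with a set of composable pairs (given by the relation
`comp`), a partially defined multiplication (encoded as a total function `mul`, whose values
only matter on composable pairs), and an involutive inverse, equipped with a topology making
multiplication (on the set of composable pairs) and inversion continuous. -/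
structure TopGroupoid (G : Type*) [TopologicalSpace G] where
  comp : G → G → Prop
  mul : G → G → G
  inv : G → G
  comp_mul_left : ∀ {g h k : G}, comp g h → comp h k → comp (mul g h) k
  comp_mul_right : ∀ {g h k : G}, comp g h → comp h k → comp g (mul h k)
  mul_assoc' : ∀ {g h k : G}, comp g h → comp h k → mul (mul g h) k = mul g (mul h k)
  inv_inv' : ∀ g : G, inv (inv g) = g
  comp_inv' : ∀ g : G, comp g (inv g)
  comp_inv_mul : ∀ {g h : G}, comp g h → comp (inv g) (mul g h)
  inv_mul_cancel' : ∀ {g h : G}, comp g h → mul (inv g) (mul g h) = h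
  comp_mul_inv : ∀ {g h : G}, comp g h → comp (mul g h) (inv h)
  mul_inv_cancel' : ∀ {g h : G}, comp g h → mul (mul g h) (inv h) = g
  continuous_mul : ContinuousOn (fun p : G × G => mul p.1 p.2) {p : G × G | comp p.1 p.2}
  continuous_inv : Continuous inv

namespace TopGroupoid

variable {G : Type*} [TopologicalSpace G] (S : TopGroupoid G)

/-- The set of units `G⁽⁰⁾ = {g : g = g⁻¹ = g²}`. -/
def unitSet : Set G := {g | S.comp g g ∧ S.inv g = g ∧ S.mul g g = g}

/-- The domain map `d(g) = g⁻¹g`. -/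
def d (g : G) : G := S.mul (S.inv g) g

/-- The range map `r(g) = gg⁻¹`. -/
def r (g : G) : G := S.mul g (S.inv g)

/-- A topological groupoid is étale if its domain map is a local homeomorphism. -/
def IsEtale : Prop := IsLocalHomeomorph S.d

/-- A topological groupoid is ample if it is étale and its unit space is totally
disconnected. -/
def IsAmple : Prop := S.IsEtale ∧ IsTotallyDisconnected S.unitSet

end TopGroupoid

/-- A twist `G⁽⁰⁾ × 𝕋 → Σ → G` over a topological groupoid `G`: a central extension of
topological groupoids, where `i` is a homeomorphism onto `j⁻¹(G⁽⁰⁾)`, `j` is a continuous open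
surjection, both are groupoid homomorphisms, and the extension is central. The unit space of
`Σ` is identified with `G⁽⁰⁾` via `j`. -/
structure Twist {G Sg : Type*} [TopologicalSpace G] [TopologicalSpace Sg]
    (SG : TopGroupoid G) (SS : TopGroupoid Sg) where
  i : ↥SG.unitSet × Circle → Sg
  j : Sg → G
  continuous_i : Continuous i
  isEmbedding_i : Topology.IsEmbedding i
  range_i : Set.range i = j ⁻¹' SG.unitSet
  i_comp : ∀ (u : ↥SG.unitSet) (z w : Circle), SS.comp (i (u, z)) (i (u, w))
  i_mul : ∀ (u : ↥SG.unitSet) (z w : Circle), SS.mul (i (u, z)) (i (u, w)) = i (u, z * w)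
  i_inv : ∀ (u : ↥SG.unitSet) (z : Circle), SS.inv (i (u, z)) = i (u, z⁻¹)
  continuous_j : Continuous j
  isOpenMap_j : IsOpenMap j
  surjective_j : Function.Surjective j
  j_comp : ∀ {σ τ : Sg}, SS.comp σ τ → SG.comp (j σ) (j τ)
  j_mul : ∀ {σ τ : Sg}, SS.comp σ τ → j (SS.mul σ τ) = SG.mul (j σ) (j τ)
  j_inv : ∀ σ : Sg, j (SS.inv σ) = SG.inv (j σ)
  j_i : ∀ (u : ↥SG.unitSet) (z : Circle), j (i (u, z)) = (u : G)
  j_r_unit : ∀ σ : Sg, j (SS.r σ) ∈ SG.unitSet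
  j_d_unit : ∀ σ : Sg, j (SS.d σ) ∈ SG.unitSet
  comp_central : ∀ (σ : Sg) (z : Circle),
    SS.comp (i (⟨j (SS.r σ), j_r_unit σ⟩, z)) σ ∧ SS.comp σ (i (⟨j (SS.d σ), j_d_unit σ⟩, z))
  central : ∀ (σ : Sg) (z : Circle),
    SS.mul (i (⟨j (SS.r σ), j_r_unit σ⟩, z)) σ = SS.mul σ (i (⟨j (SS.d σ), j_d_unit σ⟩, z))

/-- The canonical action of the circle `𝕋` on a twist: `z • σ := i(r(σ), z)σ`. -/
def Twist.smul {G Sg : Type*} [TopologicalSpace G] [TopologicalSpace Sg]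
    {SG : TopGroupoid G} {SS : TopGroupoid Sg} (T : Twist SG SS) (z : Circle) (σ : Sg) : Sg :=
  SS.mul (T.i (⟨T.j (SS.r σ), T.j_r_unit σ⟩, z)) σ

namespace TopGroupoid

variable {G : Type*} [TopologicalSpace G] (S : TopGroupoid G)

theorem comp_inv_self (g : G) : S.comp (S.inv g) g := by
  have h := S.comp_inv' (S.inv g)
  rwa [S.inv_inv'] at h

theorem r_mul_self (g : G) : S.mul (S.r g) g = g := by
  have h := S.mul_inv_cancel' (S.comp_inv' g)
  rwa [S.inv_inv'] at h

theorem r_inv (g : G) : S.r (S.inv g) = S.d g := by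
  simp only [r, d, S.inv_inv']

theorem d_mul_self (g : G) : S.mul (S.d g) (S.d g) = S.d g := by
  have h1 := S.comp_inv_self g
  have h2 := S.comp_inv' g
  show S.mul (S.mul (S.inv g) g) (S.mul (S.inv g) g) = S.mul (S.inv g) g
  rw [S.mul_assoc' h1 (S.comp_mul_right h2 h1), ← S.mul_assoc' h2 h1]
  congr 1
  exact S.r_mul_self g

theorem mul_d_self (g : G) : S.mul g (S.d g) = g := by
  have h := S.inv_mul_cancel' (S.comp_inv_self g)
  rwa [S.inv_inv'] at h

theorem comp_d (g : G) : S.comp g (S.d g) :=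
  S.comp_mul_right (S.comp_inv' g) (S.comp_inv_self g)

theorem comp_r (g : G) : S.comp (S.r g) g :=
  S.comp_mul_left (S.comp_inv' g) (S.comp_inv_self g)

theorem comp_of_d_eq_r {g h : G} (e : S.d g = S.r h) : S.comp g h := by
  have h1 : S.comp (S.d g) h := by rw [e]; exact S.comp_r h
  have h2 := S.comp_mul_left (S.comp_d g) h1
  rwa [S.mul_d_self] at h2

end TopGroupoid

section TwistLemmas

variable {H Sg : Type*} [TopologicalSpace H] [TopologicalSpace Sg]
    {SH : TopGroupoid H} {SS : TopGroupoid Sg} (T : Twist SH SS)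

theorem Twist.j_d (σ : Sg) : T.j (SS.d σ) = SH.d (T.j σ) := by
  simp only [TopGroupoid.d]
  rw [T.j_mul (SS.comp_inv_self σ), T.j_inv]

theorem Twist.j_r (σ : Sg) : T.j (SS.r σ) = SH.r (T.j σ) := by
  simp only [TopGroupoid.r]
  rw [T.j_mul (SS.comp_inv' σ), T.j_inv]

theorem Twist.d_eq (σ : Sg) : SS.d σ = T.i (⟨T.j (SS.d σ), T.j_d_unit σ⟩, 1) := by
  have hm : SS.d σ ∈ Set.range T.i := by
    rw [T.range_i]; exact T.j_d_unit σ
  obtain ⟨⟨u, z⟩, hu⟩ := hm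
  have h := SS.d_mul_self σ
  rw [← hu, T.i_mul] at h
  have h2 := T.isEmbedding_i.injective h
  have hz : z = 1 := by
    have := congrArg Prod.snd h2
    simpa using this
  subst hz
  have hju : T.j (SS.d σ) = u := by rw [← hu, T.j_i]
  conv_lhs => rw [← hu]
  congr 2
  exact Subtype.ext hju.symm

theorem Twist.d_eq_d {σ τ : Sg} (h : T.j σ = T.j τ) : SS.d σ = SS.d τ := by
  rw [T.d_eq σ, T.d_eq τ]
  congr 2
  apply Subtype.ext
  show T.j (SS.d σ) = T.j (SS.d τ)
  rw [T.j_d, T.j_d, h]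

theorem Twist.comp_inv_of_j_eq {σ τ : Sg} (h : T.j σ = T.j τ) : SS.comp σ (SS.inv τ) :=
  SS.comp_of_d_eq_r (by rw [SS.r_inv, T.d_eq_d h])

theorem Twist.j_smul (z : Circle) (σ : Sg) : T.j (T.smul z σ) = T.j σ := by
  unfold Twist.smul
  rw [T.j_mul (T.comp_central σ z).1, T.j_i]
  show SH.mul (T.j (SS.r σ)) (T.j σ) = T.j σ
  rw [T.j_r, SH.r_mul_self]

theorem Twist.exists_smul {W : Type*} [TopologicalSpace W] {A B : W → Sg}
    (hA : Continuous A) (hB : Continuous B) (h : ∀ w, T.j (A w) = T.j (B w)) :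
    ∃ z : W → Circle, Continuous z ∧ ∀ w, T.smul (z w) (B w) = A w := by
  have hc : ∀ w, SS.comp (A w) (SS.inv (B w)) := fun w => T.comp_inv_of_j_eq (h w)
  have hρ : Continuous fun w => SS.mul (A w) (SS.inv (B w)) :=
    SS.continuous_mul.comp_continuous (hA.prodMk (SS.continuous_inv.comp hB)) hc
  have hj : ∀ w, T.j (SS.mul (A w) (SS.inv (B w))) = T.j (SS.r (B w)) := by
    intro w
    rw [T.j_mul (hc w), h, T.j_r, T.j_inv]
    rfl
  have hm : ∀ w, ∃ p, T.i p = SS.mul (A w) (SS.inv (B w)) := by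
    intro w
    have : SS.mul (A w) (SS.inv (B w)) ∈ Set.range T.i := by
      rw [T.range_i, Set.mem_preimage, hj]
      exact T.j_r_unit _
    exact this
  choose k hk using hm
  have hkc : Continuous k := by
    rw [T.isEmbedding_i.continuous_iff]
    have : T.i ∘ k = fun w => SS.mul (A w) (SS.inv (B w)) := funext hk
    rwa [this]
  refine ⟨fun w => (k w).2, continuous_snd.comp hkc, fun w => ?_⟩
  have e : ((⟨T.j (SS.r (B w)), T.j_r_unit (B w)⟩, (k w).2) : ↥SH.unitSet × Circle) = k w := by
    refine Prod.ext (Subtype.ext ?_) rfl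
    show T.j (SS.r (B w)) = (k w).1
    rw [← hj, ← hk, ← T.j_i (k w).1 (k w).2]
  unfold Twist.smul
  rw [e, hk]
  have := SS.mul_inv_cancel' (hc w)
  rwa [SS.inv_inv'] at this

theorem Twist.continuous_smul {W : Type*} [TopologicalSpace W] {z : W → Circle} {B : W → Sg}
    (hz : Continuous z) (hB : Continuous B) : Continuous fun w => T.smul (z w) (B w) := by
  have hr : Continuous fun w => SS.r (B w) :=
    SS.continuous_mul.comp_continuous (hB.prodMk (SS.continuous_inv.comp hB))
      (fun w => SS.comp_inv' _)
  have hi : Continuous fun w =>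
      T.i (⟨T.j (SS.r (B w)), T.j_r_unit (B w)⟩, z w) :=
    T.continuous_i.comp (((T.continuous_j.comp hr).subtype_mk _).prodMk hz)
  exact SS.continuous_mul.comp_continuous (hi.prodMk hB) (fun w => (T.comp_central _ _).1)

end TwistLemmas

/-- Let `Σ` be a twist over the bundle groupoid `G × [0,1]` of a topological
groupoid `G`, let `V ⊆ G` be open and `0 ≤ a < b < c ≤ 1`. If `j` admits continuous sections
over `V × [a,b]` and over `V × [b,c]`, then `j` admits a continuous section over `V × [a,c]`. -/
theorem glue_sections_of_twist {G Sg : Type*} [TopologicalSpace G] [TopologicalSpace Sg]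
    (SG : TopGroupoid G)
    (SB : TopGroupoid (G × unitInterval))
    (hcomp : ∀ p q : G × unitInterval, SB.comp p q ↔ SG.comp p.1 q.1 ∧ p.2 = q.2)
    (hmul : ∀ p q : G × unitInterval, SB.mul p q = (SG.mul p.1 q.1, p.2))
    (hinv : ∀ p : G × unitInterval, SB.inv p = (SG.inv p.1, p.2))
    (SS : TopGroupoid Sg) (T : Twist SB SS)
    (V : Set G) (hV : IsOpen V)
    (a b c : unitInterval) (hab : a < b) (hbc : b < c)
    (s₁ : G × unitInterval → Sg) (hs₁ : ContinuousOn s₁ (V ×ˢ Set.Icc a b))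
    (hsec₁ : ∀ w ∈ V ×ˢ Set.Icc a b, T.j (s₁ w) = w)
    (s₂ : G × unitInterval → Sg) (hs₂ : ContinuousOn s₂ (V ×ˢ Set.Icc b c))
    (hsec₂ : ∀ w ∈ V ×ˢ Set.Icc b c, T.j (s₂ w) = w) :
    ∃ s : G × unitInterval → Sg, ContinuousOn s (V ×ˢ Set.Icc a c) ∧
      ∀ w ∈ V ×ˢ Set.Icc a c, T.j (s w) = w := by
  classical
  have hv : Continuous fun w : ↥(V ×ˢ Set.Icc a c) => w.1.1 :=
    continuous_fst.comp continuous_subtype_val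
  have ht : Continuous fun w : ↥(V ×ˢ Set.Icc a c) => w.1.2 :=
    continuous_snd.comp continuous_subtype_val
  have m1 : ∀ w : ↥(V ×ˢ Set.Icc a c), (w.1.1, min w.1.2 b) ∈ V ×ˢ Set.Icc a b := fun w =>
    ⟨w.2.1, le_min w.2.2.1 hab.le, min_le_right _ _⟩
  have m2 : ∀ w : ↥(V ×ˢ Set.Icc a c), (w.1.1, max w.1.2 b) ∈ V ×ˢ Set.Icc b c := fun w =>
    ⟨w.2.1, le_max_right _ _, max_le w.2.2.2 hbc.le⟩
  have n1 : ∀ w : ↥(V ×ˢ Set.Icc a c), (w.1.1, b) ∈ V ×ˢ Set.Icc a b := fun w =>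
    ⟨w.2.1, hab.le, le_rfl⟩
  have n2 : ∀ w : ↥(V ×ˢ Set.Icc a c), (w.1.1, b) ∈ V ×ˢ Set.Icc b c := fun w =>
    ⟨w.2.1, le_rfl, hbc.le⟩
  have cA := hs₁.comp_continuous (hv.prodMk (ht.min continuous_const)) m1
  have cB := hs₂.comp_continuous (hv.prodMk (ht.max continuous_const)) m2
  have cA0 := hs₁.comp_continuous (hv.prodMk continuous_const) n1
  have cB0 := hs₂.comp_continuous (hv.prodMk continuous_const) n2
  obtain ⟨z, hz, hzs⟩ := T.exists_smul cA0 cB0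
    (fun w => (hsec₁ _ (n1 w)).trans (hsec₂ _ (n2 w)).symm)
  have hF := Continuous.if_le cA (T.continuous_smul hz cB) ht (continuous_const (y := b)) (by
    intro w hw
    have := hzs w
    have hw' : w.1.2 = b := hw
    simp only [Function.comp_apply] at this ⊢
    rw [hw', min_self, max_self]
    exact this.symm)
  refine ⟨fun w => if h : w ∈ V ×ˢ Set.Icc a c then
    (if w.2 ≤ b then s₁ (w.1, min w.2 b) else T.smul (z ⟨w, h⟩) (s₂ (w.1, max w.2 b)))
    else s₁ w, ?_, ?_⟩
  · rw [continuousOn_iff_continuous_domRestrict]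
    convert hF using 1
    funext w
    simp only [Set.domRestrict_apply, dif_pos w.2, Function.comp_apply]
  · intro w hw
    simp only [dif_pos hw]
    split_ifs with h
    · rw [hsec₁ _ (m1 ⟨w, hw⟩)]
      simp [h]
    · rw [T.j_smul, hsec₂ _ (m2 ⟨w, hw⟩)]
      simp [(not_le.1 h).le]
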